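/- Work in ℝ[x, y] with fraction field ℝ(x, y). Set t = xy − 1, h = t(xt + 1), f = (xt + 1)²(t² + y), P = f + h, q = −t² − 6th(h + 1), u = 170fh + 91h² + 195fh² + 69h³ + 75fh³ + (75/4)h⁴, and Q = q − u. Then for every subfield k of ℝ (in particular k = ℝ), the only field automorphism of k(x, y) that fixes every element of the subfield k(P, Q) is the identity; in particular, since the extension k(P, Q) ⊆ k(x, y) has degree 6 > 1, this extension is not Galois. -/

import Mathlib

section aux

open Polynomial

theorem lemA {E L : Type*} [Field E] [Field L] [Algebra E L] (s g : L)
    (hs : Transcendental E s) (n0 n1 n2 n3 n4 n5 n6 : E) (h0 : n0 ≠ 0) (h1 : n1 ≠ 0)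
    (h6 : n6 ≠ 0) (hg : g ∈ IntermediateField.adjoin E {s}) (hg0 : g ≠ 0)
    (N : E[X]) (hN : N = C n0 + C n1 * X + C n2 * X ^ 2 + C n3 * X ^ 3 + C n4 * X ^ 4
      + C n5 * X ^ 5 + C n6 * X ^ 6)
    (heq : aeval g N * s ^ 2 = aeval s N * g ^ 2) : g = s := by
  have inj : Function.Injective (aeval (R := E) s) := transcendental_iff_injective.mp hs
  obtain ⟨A, B, hB, hco, hgAB⟩ : ∃ A B : E[X], aeval s B ≠ 0 ∧ IsCoprime A B ∧
      g = aeval s A / aeval s B := by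
    obtain ⟨r, q, h⟩ := (IntermediateField.mem_adjoin_simple_iff E g).1 hg
    have hq : aeval s q ≠ 0 := by intro h'; rw [h'] at h; simp at h; exact hg0 h
    classical
    let _i := EuclideanDomain.gcdMonoid E[X]
    obtain ⟨A, B, hr, hq', hc⟩ := extract_gcd r q
    generalize gcd r q = d at hr hq'
    rw [hr, hq', map_mul, map_mul] at h
    rw [hq', map_mul] at hq
    refine ⟨A, B, right_ne_zero_of_mul hq, ?_, ?_⟩
    · exact (gcd_isUnit_iff _ _).1 hc
    · rw [h, mul_div_mul_left _ _ (left_ne_zero_of_mul hq)]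
  have hA : aeval s A ≠ 0 := by intro h'; rw [h'] at hgAB; simp at hgAB; exact hg0 hgAB
  have hA0 : A ≠ 0 := by rintro rfl; simp at hA
  have hB0 : B ≠ 0 := by rintro rfl; simp at hB
  have key : (C n0 * B ^ 6 + C n1 * A * B ^ 5 + C n2 * A ^ 2 * B ^ 4 + C n3 * A ^ 3 * B ^ 3
      + C n4 * A ^ 4 * B ^ 2 + C n5 * A ^ 5 * B + C n6 * A ^ 6) * X ^ 2 = N * (A ^ 2 * B ^ 4) := by
    apply inj
    rw [hgAB, hN] at heq
    rw [hN]
    simp only [map_add, map_mul, map_pow, aeval_C, aeval_X] at heq ⊢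
    field_simp at heq
    linear_combination heq
  have u0 : IsUnit (C n0) := isUnit_C.2 h0.isUnit
  have u6 : IsUnit (C n6) := isUnit_C.2 h6.isUnit
  have cA : IsCoprime A (C n0 * B ^ 6 + C n1 * A * B ^ 5 + C n2 * A ^ 2 * B ^ 4 + C n3 * A ^ 3 * B ^ 3
      + C n4 * A ^ 4 * B ^ 2 + C n5 * A ^ 5 * B + C n6 * A ^ 6) := by
    have : IsCoprime A (C n0 * B ^ 6) := (isCoprime_mul_unit_left_right u0 _ _).2 hco.pow_right
    have h := this.add_mul_left_right (C n1 * B ^ 5 + C n2 * A * B ^ 4 + C n3 * A ^ 2 * B ^ 3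
      + C n4 * A ^ 3 * B ^ 2 + C n5 * A ^ 4 * B + C n6 * A ^ 5)
    ring_nf at h ⊢
    exact h
  have cB : IsCoprime B (C n0 * B ^ 6 + C n1 * A * B ^ 5 + C n2 * A ^ 2 * B ^ 4 + C n3 * A ^ 3 * B ^ 3
      + C n4 * A ^ 4 * B ^ 2 + C n5 * A ^ 5 * B + C n6 * A ^ 6) := by
    have : IsCoprime B (C n6 * A ^ 6) := (isCoprime_mul_unit_left_right u6 _ _).2 hco.symm.pow_right
    have h := this.add_mul_left_right (C n0 * B ^ 5 + C n1 * A * B ^ 4 + C n2 * A ^ 2 * B ^ 3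
      + C n3 * A ^ 3 * B ^ 2 + C n4 * A ^ 4 * B + C n5 * A ^ 5)
    ring_nf at h ⊢
    exact h
  have cAB := (cA.pow_left (m := 2)).mul_left (cB.pow_left (m := 4))
  have d1 : A ^ 2 * B ^ 4 ∣ X ^ 2 := cAB.dvd_of_dvd_mul_left ⟨N, by rw [key]; ring⟩
  have dg := natDegree_le_of_dvd d1 (by simp)
  rw [natDegree_mul (by simp [hA0]) (by simp [hB0]), natDegree_pow, natDegree_pow, natDegree_X_pow] at dg
  have hBd : B.natDegree = 0 := by omega
  have hAd : A.natDegree ≤ 1 := by omega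
  obtain ⟨b, rfl⟩ := natDegree_eq_zero.1 hBd
  obtain ⟨a1, a0, rfl⟩ := exists_eq_X_add_C_of_natDegree_le_one hAd
  have hb : b ≠ 0 := by rintro rfl; simp at hB0
  have e0 := congrArg (eval 0) key
  rw [hN] at e0
  simp at e0
  have ha0 : a0 = 0 := by simpa [h0, hb] using e0
  subst ha0
  have key2 : C n0 * C b ^ 6 + C n1 * C a1 * C b ^ 5 * X + C n2 * C a1 ^ 2 * C b ^ 4 * X ^ 2
      + C n3 * C a1 ^ 3 * C b ^ 3 * X ^ 3 + C n4 * C a1 ^ 4 * C b ^ 2 * X ^ 4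
      + C n5 * C a1 ^ 5 * C b * X ^ 5 + C n6 * C a1 ^ 6 * X ^ 6 = N * (C a1 ^ 2 * C b ^ 4) := by
    have hX : (X : E[X]) ^ 2 ≠ 0 := by simp
    apply mul_right_cancel₀ hX
    simp only [map_zero, add_zero] at key
    linear_combination key
  have k1 := congrArg (fun q => eval 0 (derivative q)) key2
  rw [hN] at k1
  simp [derivative_pow] at k1
  have ha1 : a1 ≠ 0 := by rintro rfl; simp at hA0
  have k1' : b = a1 := by
    have : n1 * b ^ 4 * a1 * (b - a1) = 0 := by linear_combination k1
    simpa [h1, hb, ha1, sub_eq_zero] using this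
  subst k1'
  rw [hgAB]
  have : algebraMap E L b ≠ 0 := by simpa using hb
  simp
  field_simp

theorem lemB {E L : Type*} [Field E] [Field L] [Algebra E L] (s Q : L)
    (hs : Transcendental E s) (N : E[X]) (hN : N.natDegree = 6)
    (heq : Q * s ^ 2 = aeval s N) : s ∉ IntermediateField.adjoin E {Q} := by
  have inj : Function.Injective (aeval (R := E) s) := transcendental_iff_injective.mp hs
  have hs0 : s ≠ 0 := by
    rintro rfl
    exact hs isAlgebraic_zero
  have hN0 : N ≠ 0 := by rintro rfl; simp at hN
  have main : ∀ d : ℕ, ∀ A : E[X], A.natDegree = d → A ≠ 0 →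
      ∃ A' : E[X], aeval s A' = aeval Q A * s ^ (2 * d) ∧ A' ≠ 0 ∧ A'.natDegree = 6 * d := by
    intro d
    induction d with
    | zero =>
      intro A hA hA0
      obtain ⟨a, rfl⟩ := natDegree_eq_zero.1 hA
      exact ⟨C a, by simp, hA0, by simp⟩
    | succ d ih =>
      intro A hA hA0
      have h1 : (divX A).natDegree = d := by rw [natDegree_divX_eq_natDegree_tsub_one, hA]; rfl
      have h2 : divX A ≠ 0 := by
        intro h
        have := divX_mul_X_add A
        rw [h] at this
        rw [← this] at hA
        simp at hA
      obtain ⟨A1, e, hne, hd⟩ := ih _ h1 h2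
      have hdeg : (A1 * N + C (A.coeff 0) * X ^ (2 * (d + 1))).natDegree = 6 * (d + 1) := by
        rw [natDegree_add_eq_left_of_natDegree_lt, natDegree_mul hne hN0, hd, hN]
        · ring
        · rw [natDegree_mul hne hN0, hd, hN]
          have := natDegree_C_mul_X_pow_le (A.coeff 0) (2 * (d + 1))
          omega
      refine ⟨A1 * N + C (A.coeff 0) * X ^ (2 * (d + 1)), ?_, ?_, hdeg⟩
      · conv_rhs => rw [← divX_mul_X_add A]
        simp only [map_add, map_mul, map_pow, aeval_C, aeval_X, e, ← heq]
        ring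
      · intro h
        rw [h] at hdeg
        simp at hdeg
        
  intro hmem
  obtain ⟨A, B, h⟩ := (IntermediateField.mem_adjoin_simple_iff E s).1 hmem
  have hB : aeval Q B ≠ 0 := by intro h'; rw [h'] at h; simp at h; exact hs0 h
  have hA : aeval Q A ≠ 0 := by intro h'; rw [h'] at h; simp at h; exact hs0 h
  obtain ⟨A', eA, A0, dA⟩ := main _ A rfl (by rintro rfl; simp at hA)
  obtain ⟨B', eB, B0, dB⟩ := main _ B rfl (by rintro rfl; simp at hB)
  have : X * B' * X ^ (2 * A.natDegree) = A' * X ^ (2 * B.natDegree) := by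
    apply inj
    simp only [map_mul, map_pow, aeval_X, eA, eB]
    rw [eq_div_iff hB] at h
    linear_combination (s ^ (2 * A.natDegree) * s ^ (2 * B.natDegree)) * h
  have := congrArg natDegree this
  rw [natDegree_mul (by simp [B0]) (by simp), natDegree_mul (by simp) B0,
    natDegree_mul A0 (by simp), natDegree_X_pow, natDegree_X_pow, natDegree_X, dA, dB] at this
  omega

end aux


noncomputable section

open MvPolynomial

/-- `t = xy − 1`. -/
def pinchukT (k : Type*) [Field k] : MvPolynomial (Fin 2) k := X 0 * X 1 - 1

/-- `h = t(xt + 1)`. -/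
def pinchukH (k : Type*) [Field k] : MvPolynomial (Fin 2) k :=
  pinchukT k * (X 0 * pinchukT k + 1)

/-- `f = (xt + 1)²(t² + y)`. -/
def pinchukF (k : Type*) [Field k] : MvPolynomial (Fin 2) k :=
  (X 0 * pinchukT k + 1) ^ 2 * (pinchukT k ^ 2 + X 1)

/-- `P = f + h`. -/
def pinchukP (k : Type*) [Field k] : MvPolynomial (Fin 2) k := pinchukF k + pinchukH k

/-- `q = −t² − 6th(h + 1)`. -/
def pinchukq (k : Type*) [Field k] : MvPolynomial (Fin 2) k :=
  -pinchukT k ^ 2 - 6 * pinchukT k * pinchukH k * (pinchukH k + 1)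

/-- `u = 170fh + 91h² + 195fh² + 69h³ + 75fh³ + (75/4)h⁴`. -/
def pinchukU (k : Type*) [Field k] : MvPolynomial (Fin 2) k :=
  170 * pinchukF k * pinchukH k + 91 * pinchukH k ^ 2 + 195 * pinchukF k * pinchukH k ^ 2 +
    69 * pinchukH k ^ 3 + 75 * pinchukF k * pinchukH k ^ 3 + C (75 / 4 : k) * pinchukH k ^ 4

/-- `Q = q − u`. -/
def pinchukQ (k : Type*) [Field k] : MvPolynomial (Fin 2) k := pinchukq k - pinchukU k

/-- The subfield `k(P, Q)` of `k(x, y)`. -/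
def kPQ (k : Type*) [Field k] :
    IntermediateField k (FractionRing (MvPolynomial (Fin 2) k)) :=
  IntermediateField.adjoin k
    ({algebraMap (MvPolynomial (Fin 2) k) (FractionRing (MvPolynomial (Fin 2) k)) (pinchukP k),
      algebraMap (MvPolynomial (Fin 2) k) (FractionRing (MvPolynomial (Fin 2) k)) (pinchukQ k)} :
      Set (FractionRing (MvPolynomial (Fin 2) k)))

theorem pk_ne (k : Type*) [Field k] (p : MvPolynomial (Fin 2) k)
    (h : MvPolynomial.eval ![1, 2] p ≠ 0) :
    algebraMap (MvPolynomial (Fin 2) k) (FractionRing (MvPolynomial (Fin 2) k)) p ≠ 0 := by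
  intro h0
  have : p = 0 := (IsFractionRing.injective (MvPolynomial (Fin 2) k)
    (FractionRing (MvPolynomial (Fin 2) k))) (by simpa using h0)
  rw [this] at h
  simp at h

/-- Generators of the rational function field. -/
theorem pk_top (k : Type*) [Field k] {E : Subfield (FractionRing (MvPolynomial (Fin 2) k))}
    (hk : ∀ c : k, algebraMap k (FractionRing (MvPolynomial (Fin 2) k)) c ∈ E)
    (hx : algebraMap (MvPolynomial (Fin 2) k) (FractionRing (MvPolynomial (Fin 2) k)) (X 0) ∈ E)
    (hy : algebraMap (MvPolynomial (Fin 2) k) (FractionRing (MvPolynomial (Fin 2) k)) (X 1) ∈ E)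
    (z : FractionRing (MvPolynomial (Fin 2) k)) : z ∈ E := by
  have hp : ∀ p : MvPolynomial (Fin 2) k,
      algebraMap (MvPolynomial (Fin 2) k) (FractionRing (MvPolynomial (Fin 2) k)) p ∈ E := by
    intro p
    induction p using MvPolynomial.induction_on with
    | C a => exact hk a
    | add p q hp hq => rw [map_add]; exact E.add_mem hp hq
    | mul_X p i hp =>
      rw [map_mul]
      refine E.mul_mem hp ?_
      fin_cases i
      · exact hx
      · exact hy
  obtain ⟨a, b, -, rfl⟩ := IsFractionRing.div_surjective (A := MvPolynomial (Fin 2) k) z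
  exact E.div_mem (hp a) (hp b)

theorem pk_rel {L : Type*} [Field L] [CharZero L] (x y t h f P Q : L) (ht : t = x * y - 1)
    (hh : h = t * (x * t + 1)) (hf : f = (x * t + 1) ^ 2 * (t ^ 2 + y)) (hP : P = f + h)
    (hQ : Q = -t ^ 2 - 6 * t * h * (h + 1) - (170 * f * h + 91 * h ^ 2 + 195 * f * h ^ 2 +
      69 * h ^ 3 + 75 * f * h ^ 3 + (75 / 4) * h ^ 4)) :
    Q * f ^ 2 = (-P ^ 4 * (P + 1) ^ 2) + (12 * P ^ 3 * (P + 1) ^ 2) * f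
      + (-128 * P ^ 2 - 151 * P ^ 3 - 255 / 4 * P ^ 4) * f ^ 2
      + (54 * P + 134 * P ^ 2 + 80 * P ^ 3) * f ^ 3
      + (63 + 99 * P + 75 / 2 * P ^ 2) * f ^ 4 + (-104 - 114 * P) * f ^ 5
      + 197 / 4 * f ^ 6 := by
  have e1 : f * (h - t) = h ^ 2 * (h + 1) := by rw [hf, hh, ht]; ring
  have e2 : t * f = h * f - h ^ 2 * (h + 1) := by linear_combination -e1
  have e3 : Q * f ^ 2 = -(t * f) ^ 2 - 6 * (t * f) * f * h * (h + 1) - f ^ 2 * (170 * f * h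
      + 91 * h ^ 2 + 195 * f * h ^ 2 + 69 * h ^ 3 + 75 * f * h ^ 3 + (75 / 4) * h ^ 4) := by
    rw [hQ]; ring
  have e4 : h = P - f := by rw [hP]; ring
  rw [e3, e2, e4]
  ring

/-- The image of a polynomial in the fraction field. -/
abbrev inL (k : Type*) [Field k] (p : MvPolynomial (Fin 2) k) :
    FractionRing (MvPolynomial (Fin 2) k) :=
  algebraMap (MvPolynomial (Fin 2) k) (FractionRing (MvPolynomial (Fin 2) k)) p

theorem pk_gen (k : Type*) [Field k] [CharZero k]
    {E : Subfield (FractionRing (MvPolynomial (Fin 2) k))}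
    (hk : ∀ c : k, algebraMap k (FractionRing (MvPolynomial (Fin 2) k)) c ∈ E)
    (hP : inL k (pinchukP k) ∈ E) (hf : inL k (pinchukF k) ∈ E)
    (z : FractionRing (MvPolynomial (Fin 2) k)) : z ∈ E := by
  have f0 : inL k (pinchukF k) ≠ 0 := pk_ne k _ (by
    simp [pinchukF, pinchukT]; norm_num)
  have t0 : inL k (pinchukT k) ≠ 0 := pk_ne k _ (by
    simp [pinchukT]; norm_num)
  have ht0 : inL k (pinchukH k - pinchukT k) ≠ 0 := pk_ne k _ (by
    simp [pinchukH, pinchukT]; norm_num)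
  rw [inL, map_sub] at ht0
  have eP : inL k (pinchukP k) = inL k (pinchukF k) + inL k (pinchukH k) := map_add _ _ _
  have hH : inL k (pinchukH k) ∈ E := by
    have : inL k (pinchukH k) = inL k (pinchukP k) - inL k (pinchukF k) := by rw [eP]; ring
    rw [this]; exact E.sub_mem hP hf
  have et : inL k (pinchukT k) = inL k (X 0) * inL k (X 1) - 1 := by
    simp [inL, pinchukT]
  have eh : inL k (pinchukH k) = inL k (pinchukT k) * (inL k (X 0) * inL k (pinchukT k) + 1) := by
    simp [inL, pinchukH]
  have ef : inL k (pinchukF k) = (inL k (X 0) * inL k (pinchukT k) + 1) ^ 2 *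
      (inL k (pinchukT k) ^ 2 + inL k (X 1)) := by
    simp [inL, pinchukF]
  generalize inL k (pinchukP k) = P at *
  generalize inL k (pinchukF k) = f at *
  change inL k (pinchukH k) - inL k (pinchukT k) ≠ 0 at ht0
  generalize inL k (pinchukH k) = h at *
  have hX := pk_top k (E := E) hk
  change inL k (X 0) ∈ E → inL k (X 1) ∈ E → _ at hX
  generalize inL k (pinchukT k) = t at *
  generalize inL k (X 0) = x at *
  generalize inL k (X 1) = y at *
  have e1 : f * (h - t) = h ^ 2 * (h + 1) := by rw [ef, eh, et]; ring
  have hT : t ∈ E := by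
    have : t = h - h ^ 2 * (h + 1) / f := by
      rw [eq_sub_iff_add_eq, ← eq_sub_iff_add_eq', div_eq_iff f0]; linear_combination -e1
    rw [this]
    exact E.sub_mem hH (E.div_mem (E.mul_mem (E.pow_mem hH 2) (E.add_mem hH E.one_mem)) hf)
  refine hX ?_ ?_ z
  · have : x = (h - t) / t ^ 2 := by
      rw [eq_div_iff (pow_ne_zero 2 t0), eh]; ring
    rw [this]
    exact E.div_mem (E.sub_mem hH hT) (E.pow_mem hT 2)
  · have : y = (t + 1) * t ^ 2 / (h - t) := by
      rw [eq_div_iff ht0, eh]; linear_combination (-t ^ 2) * et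
    rw [this]
    exact E.div_mem (E.mul_mem (E.add_mem hT E.one_mem) (E.pow_mem hT 2)) (E.sub_mem hH hT)

theorem pk_adj (k : Type*) [Field k] [CharZero k] :
    IntermediateField.adjoin (IntermediateField.adjoin k {inL k (pinchukP k)})
      {inL k (pinchukF k)} = ⊤ := by
  set E := IntermediateField.adjoin k {inL k (pinchukP k)} with hE
  rw [eq_top_iff]
  rintro z -
  refine pk_gen k (E := (IntermediateField.adjoin E {inL k (pinchukF k)}).toSubfield) ?_ ?_ ?_ z
  · intro c
    exact (IntermediateField.adjoin E {inL k (pinchukF k)}).algebraMap_mem (algebraMap k E c)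
  · exact (IntermediateField.adjoin E {inL k (pinchukF k)}).algebraMap_mem
      ⟨_, IntermediateField.mem_adjoin_simple_self k _⟩
  · exact IntermediateField.mem_adjoin_simple_self E _

open scoped IntermediateField.algebraAdjoinAdjoin in
theorem pk_trdeg_le {k L : Type*} [Field k] [Field L] [Algebra k L] (P : L)
    (h : Algebra.IsAlgebraic (IntermediateField.adjoin k {P}) L) : Algebra.trdeg k L ≤ 1 := by
  have : Algebra.IsAlgebraic (Algebra.adjoin k {P}) L :=
    Algebra.IsAlgebraic.trans _ (IntermediateField.adjoin k {P}) _
  have := Algebra.IsAlgebraic.trdeg_le_cardinalMk k (A := L) {P}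
  simpa using this

theorem pk_mem {k L : Type*} [Field k] [Field L] [Algebra k L] (P Q z : L)
    (h : z ∈ IntermediateField.adjoin k {P, Q}) :
    z ∈ IntermediateField.adjoin (IntermediateField.adjoin k {P}) {Q} := by
  rw [← IntermediateField.adjoin_simple_adjoin_simple] at h
  exact h

theorem pk_trans (k : Type*) [Field k] [CharZero k] :
    Transcendental (IntermediateField.adjoin k {inL k (pinchukP k)}) (inL k (pinchukF k)) := by
  intro halg
  set E := IntermediateField.adjoin k {inL k (pinchukP k)} with hE
  have htop := pk_adj k
  rw [← hE] at htop
  have a1 : Algebra.IsAlgebraic E (FractionRing (MvPolynomial (Fin 2) k)) := by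
    have := IntermediateField.isAlgebraic_adjoin_simple (K := E) halg.isIntegral
    rw [htop] at this
    exact ⟨fun z => by
      have := this.isAlgebraic (⟨z, trivial⟩ : (⊤ : IntermediateField E _))
      exact (isAlgebraic_algHom_iff (IntermediateField.val ⊤) Subtype.val_injective).2 this⟩
  have a2 : 2 ≤ Algebra.trdeg k (FractionRing (MvPolynomial (Fin 2) k)) := by
    have := trdeg_le_of_injective
      (IsScalarTower.toAlgHom k (MvPolynomial (Fin 2) k) (FractionRing (MvPolynomial (Fin 2) k)))
      (IsFractionRing.injective _ _)
    rw [MvPolynomial.trdeg_of_isDomain] at this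
    simpa using this
  have a3 : Algebra.trdeg k (FractionRing (MvPolynomial (Fin 2) k)) ≤ 1 := pk_trdeg_le _ a1
  have := a2.trans a3
  norm_num at this

/-- The coefficients. -/
theorem pk_data (k : Type*) [Field k] [CharZero k] :
    ∃ n0 n1 n2 n3 n4 n5 n6 : IntermediateField.adjoin k {inL k (pinchukP k)},
      n0 ≠ 0 ∧ n1 ≠ 0 ∧ n6 ≠ 0 ∧ (∀ i ∈ [n0, n1, n2, n3, n4, n5, n6],
        (i : FractionRing (MvPolynomial (Fin 2) k)) ∈
          IntermediateField.adjoin k {inL k (pinchukP k)}) ∧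
      inL k (pinchukQ k) * inL k (pinchukF k) ^ 2 =
        (Polynomial.aeval (inL k (pinchukF k))) (Polynomial.C n0 + Polynomial.C n1 * Polynomial.X
          + Polynomial.C n2 * Polynomial.X ^ 2 + Polynomial.C n3 * Polynomial.X ^ 3
          + Polynomial.C n4 * Polynomial.X ^ 4 + Polynomial.C n5 * Polynomial.X ^ 5
          + Polynomial.C n6 * Polynomial.X ^ 6) := by
  have p0 : inL k (pinchukP k) ≠ 0 := pk_ne k _ (by
    simp [pinchukP, pinchukH, pinchukF, pinchukT]; norm_num)
  have p1 : inL k (pinchukP k + 1) ≠ 0 := pk_ne k _ (by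
    simp [pinchukP, pinchukH, pinchukF, pinchukT]; norm_num)
  rw [inL, map_add, map_one] at p1
  have : CharZero (FractionRing (MvPolynomial (Fin 2) k)) :=
    charZero_of_injective_algebraMap (algebraMap k _).injective
  have rel := pk_rel (inL k (X 0)) (inL k (X 1)) (inL k (pinchukT k)) (inL k (pinchukH k))
    (inL k (pinchukF k)) (inL k (pinchukP k)) (inL k (pinchukQ k))
    (by simp [inL, pinchukT]) (by simp [inL, pinchukH]) (by simp [inL, pinchukF])
    (by simp [inL, pinchukP]) (by
      have : inL k (C (75 / 4 : k)) = 75 / 4 := by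
        change algebraMap (MvPolynomial (Fin 2) k) _ (algebraMap k _ _) = _
        rw [← IsScalarTower.algebraMap_apply, map_div₀, map_ofNat, map_ofNat]
      simp only [inL, pinchukQ, pinchukq, pinchukU, map_sub, map_add, map_mul, map_pow, map_neg,
        map_ofNat, map_one] at this ⊢
      rw [this])
  let p : IntermediateField.adjoin k {inL k (pinchukP k)} :=
    ⟨_, IntermediateField.mem_adjoin_simple_self k _⟩
  have hp0 : p ≠ 0 := fun h => p0 (congrArg Subtype.val h)
  have hp1 : p + 1 ≠ 0 := fun h => p1 (congrArg Subtype.val h)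
  have : CharZero (IntermediateField.adjoin k {inL k (pinchukP k)}) :=
    charZero_of_injective_algebraMap (algebraMap k _).injective
  refine ⟨-p ^ 4 * (p + 1) ^ 2, 12 * p ^ 3 * (p + 1) ^ 2,
    -128 * p ^ 2 - 151 * p ^ 3 - 255 / 4 * p ^ 4, 54 * p + 134 * p ^ 2 + 80 * p ^ 3,
    63 + 99 * p + 75 / 2 * p ^ 2, -104 - 114 * p, 197 / 4, ?_, ?_, ?_, ?_, ?_⟩
  · exact mul_ne_zero (neg_ne_zero.2 (pow_ne_zero _ hp0)) (pow_ne_zero _ hp1)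
  · exact mul_ne_zero (mul_ne_zero (by norm_num) (pow_ne_zero _ hp0)) (pow_ne_zero _ hp1)
  · norm_num
  · intro i _
    exact i.2
  · rw [rel]
    have hp : algebraMap (IntermediateField.adjoin k {inL k (pinchukP k)})
      (FractionRing (MvPolynomial (Fin 2) k)) p = inL k (pinchukP k) := rfl
    simp only [map_add, map_mul, map_pow, Polynomial.aeval_C, Polynomial.aeval_X, map_sub, map_neg,
      map_div₀, map_ofNat, map_one, hp]

theorem pk_aut (k : Type*) [Field k] [CharZero k]
    (σ : FractionRing (MvPolynomial (Fin 2) k) ≃+* FractionRing (MvPolynomial (Fin 2) k))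
    (hσ : ∀ r ∈ kPQ k, σ r = r) : σ = RingEquiv.refl (FractionRing (MvPolynomial (Fin 2) k)) := by
  obtain ⟨n0, n1, n2, n3, n4, n5, n6, h0, h1, h6, -, hrel⟩ := pk_data k
  have hle : IntermediateField.adjoin k {inL k (pinchukP k)} ≤ kPQ k :=
    IntermediateField.adjoin.mono _ _ _ (by simp)
  have hQ : σ (inL k (pinchukQ k)) = inL k (pinchukQ k) :=
    hσ _ (IntermediateField.subset_adjoin _ _ (by simp))
  have hE : ∀ c : IntermediateField.adjoin k {inL k (pinchukP k)}, σ (algebraMap _ _ c)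
    = algebraMap _ (FractionRing (MvPolynomial (Fin 2) k)) c := fun c => hσ _ (hle c.2)
  have f0 : inL k (pinchukF k) ≠ 0 := pk_ne k _ (by
    simp [pinchukF, pinchukT]; norm_num)
  have hrel2 := congrArg σ hrel
  simp only [map_add, map_mul, map_pow, Polynomial.aeval_C, Polynomial.aeval_X, hE, hQ] at hrel2
  have hfix : σ (inL k (pinchukF k)) = inL k (pinchukF k) := by
    refine lemA (inL k (pinchukF k)) (σ (inL k (pinchukF k))) (pk_trans k)
      n0 n1 n2 n3 n4 n5 n6 h0 h1 h6 ?_ (by simpa using f0) _ rfl ?_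
    · rw [pk_adj]; trivial
    · rw [← hrel]
      simp only [map_add, map_mul, map_pow, Polynomial.aeval_C, Polynomial.aeval_X]
      rw [← hrel2]
      ring
  have hP : σ (inL k (pinchukP k)) = inL k (pinchukP k) :=
    hσ _ (IntermediateField.subset_adjoin _ _ (by simp))
  ext z
  exact pk_gen k (E := (σ : FractionRing (MvPolynomial (Fin 2) k) →+*
      FractionRing (MvPolynomial (Fin 2) k)).eqLocusField (RingHom.id _))
    (fun c => hσ _ ((kPQ k).algebraMap_mem c))
    hP hfix z

theorem pk_not_mem (k : Type*) [Field k] [CharZero k] : inL k (pinchukF k) ∉ kPQ k := by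
  obtain ⟨n0, n1, n2, n3, n4, n5, n6, h0, h1, h6, -, hrel⟩ := pk_data k
  have := lemB _ _ (pk_trans k) _ (by compute_degree!) hrel
  intro hm
  apply this
  exact pk_mem _ _ _ hm

set_option synthInstance.maxHeartbeats 1000000 in
/-- For every subfield `k` of `ℝ`, the only field automorphism of `k(x, y)`
fixing every element of `k(P, Q)` is the identity, where `(P, Q)` is the Pinchuk map; in
particular (the extension having degree `6 > 1`) the extension `k(P, Q) ⊆ k(x, y)` is not
Galois. -/
theorem pinchuk_automorphism_group_trivial (k : Subfield ℝ) :
    (∀ σ : FractionRing (MvPolynomial (Fin 2) ↥k) ≃+* FractionRing (MvPolynomial (Fin 2) ↥k),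
      (∀ r ∈ kPQ ↥k, σ r = r) → σ = RingEquiv.refl (FractionRing (MvPolynomial (Fin 2) ↥k))) ∧
    ¬ IsGalois (kPQ ↥k) (FractionRing (MvPolynomial (Fin 2) ↥k)) := by
  refine ⟨fun σ hσ => pk_aut k σ hσ, fun hG => pk_not_mem k ?_⟩
  have := (InfiniteGalois.mem_bot_iff_fixed (k := kPQ k) (inL k (pinchukF k))).2 (fun τ => by
    have h := pk_aut k τ.toRingEquiv (fun r hr => τ.commutes ⟨r, hr⟩)
    exact congrArg (fun e => e (inL k (pinchukF k))) h)
  obtain ⟨r, hr⟩ := IntermediateField.mem_bot.1 this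
  rw [← hr]
  exact r.2
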